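/- arXiv:1412.2623 — 2 statements merged into one kernel-verified Lean document; each statement's English description precedes it below -/
import Mathlib

section
/- Let n ≥ 1, m ≥ 2, d ≥ 1. Let {ρ_{a|x}} be an ensemble with common marginal ρ = Σ_a ρ_{a|x} for all x, and suppose it is steerable, i.e., there exists no family {ω_i} of positive semidefinite d×d matrices indexed by i ∈ {1,…,m}^n with ρ_{a|x} = Σ_{i : i_x = a} ω_i for all a, x. Then there exists a family {Z_i} of positive semidefinite d×d matrices, indexed by i ∈ {1,…,m}^n, satisfying the steering-map relations, such that Σ_i tr(Z_i)·tr(ω^spec_i) = 1 and Σ_i tr(Z_i · ω^spec_i) < 0. -/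
open Matrix Finset
open scoped Kronecker ComplexOrder

/-- The outcome labeled `m` in 1-based labels: the last element of `Fin m`. -/
def lastIdx {m : ℕ} (hm : 0 < m) : Fin m := ⟨m - 1, by omega⟩

/-- The steering-map relations for a family of matrices indexed by multi-indices. -/
def SteeringRel {n m d : ℕ} (Z : (Fin n → Fin m) → Matrix (Fin d) (Fin d) ℂ) : Prop :=
  ∀ i j : Fin n → Fin m,
    Z i = (∑ x : Fin n, Z (Function.update j x (i x))) - ((n : ℂ) - 1) • Z j

/-- The special solution `ω^spec` associated with an ensemble `ρ` together with a
common marginal `ρbar`. -/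
noncomputable def wspec {n m d : ℕ} (hm : 0 < m)
    (ρ : Fin n → Fin m → Matrix (Fin d) (Fin d) ℂ)
    (ρbar : Matrix (Fin d) (Fin d) ℂ) (i : Fin n → Fin m) :
    Matrix (Fin d) (Fin d) ℂ :=
  (if ∀ x, i x = lastIdx hm then
      (∑ x : Fin n, ρ x (lastIdx hm)) - ((n : ℂ) - 1) • ρbar
    else 0)
  + ∑ x : Fin n,
      if i x ≠ lastIdx hm ∧ ∀ y, y ≠ x → i y = lastIdx hm then ρ x (i x) else 0

section Duality

attribute [local instance] Matrix.normedAddCommGroup Matrix.normedSpace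

variable {l : Type*} [Fintype l]

lemma Matrix.PosSemidef.norm_apply_le_re_trace {A : Matrix l l ℂ} (hA : A.PosSemidef) (i j : l) :
    ‖A i j‖ ≤ A.trace.re := by
  classical
  obtain ⟨B, rfl⟩ : ∃ B : Matrix l l ℂ, A = Bᴴ * B := by
    open scoped MatrixOrder in
    exact CStarAlgebra.nonneg_iff_eq_star_mul_self.mp hA.nonneg
  have htr : (Bᴴ * B).trace.re = ∑ k, ∑ s, ‖B s k‖ ^ 2 := by
    simp only [Matrix.trace, Matrix.diag_apply, Matrix.mul_apply, Complex.re_sum,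
      Matrix.conjTranspose_apply]
    refine Finset.sum_congr rfl fun k _ => Finset.sum_congr rfl fun s _ => ?_
    rw [Complex.star_def, Complex.conj_mul']
    norm_cast
  have hcol (k : l) : ∑ s, ‖B s k‖ ^ 2 ≤ (Bᴴ * B).trace.re := by
    rw [htr]
    exact Finset.single_le_sum (f := fun k => ∑ s, ‖B s k‖ ^ 2)
      (fun k _ => Finset.sum_nonneg fun s _ => sq_nonneg _) (Finset.mem_univ k)
  calc ‖(Bᴴ * B) i j‖ ≤ ∑ s, ‖B s i‖ * ‖B s j‖ := by
        rw [Matrix.mul_apply]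
        refine (norm_sum_le _ _).trans_eq (Finset.sum_congr rfl fun s _ => ?_)
        simp
    _ ≤ ∑ s, (‖B s i‖ ^ 2 + ‖B s j‖ ^ 2) / 2 :=
        Finset.sum_le_sum fun s _ => by nlinarith [sq_nonneg (‖B s i‖ - ‖B s j‖)]
    _ = ((∑ s, ‖B s i‖ ^ 2) + ∑ s, ‖B s j‖ ^ 2) / 2 := by
        rw [← Finset.sum_div, Finset.sum_add_distrib]
    _ ≤ _ := by linarith [hcol i, hcol j]

lemma isClosed_setOf_posSemidef : IsClosed {A : Matrix l l ℂ | A.PosSemidef} := by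
  simp only [Matrix.posSemidef_iff_dotProduct_mulVec, Set.ofPred_and, Set.ofPred_forall]
  refine IsClosed.inter ?_ (isClosed_iInter fun v => ?_)
  · exact isClosed_eq (continuous_id.matrix_conjTranspose) continuous_id
  · exact isClosed_le continuous_const
      (continuous_const.dotProduct (continuous_id.matrix_mulVec continuous_const))

/-- Families of positive semidefinite matrices of total trace one. -/
def psdFamilies (I l : Type*) [Fintype I] [Fintype l] : Set (I → Matrix l l ℂ) :=
  {ω | (∀ i, (ω i).PosSemidef) ∧ ∑ i, (ω i).trace = 1}

lemma convex_psdFamilies (I : Type*) [Fintype I] : Convex ℝ (psdFamilies I l) := by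
  rintro ω ⟨hω, hω1⟩ ω' ⟨hω', hω'1⟩ a b ha hb hab
  refine ⟨fun i => ((hω i).smul ha).add ((hω' i).smul hb), ?_⟩
  simp only [Pi.add_apply, Pi.smul_apply, Matrix.trace_add, Matrix.trace_smul,
    Finset.sum_add_distrib, ← Finset.smul_sum, hω1, hω'1]
  rw [← add_smul, hab, one_smul]

lemma isCompact_psdFamilies (I : Type*) [Fintype I] : IsCompact (psdFamilies I l) := by
  refine Metric.isCompact_of_isClosed_isBounded ?_ ?_
  · simp only [psdFamilies, Set.ofPred_and, Set.ofPred_forall]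
    refine IsClosed.inter (isClosed_iInter fun i =>
      isClosed_setOf_posSemidef.preimage
      (f := fun ω : I → Matrix l l ℂ => ω i) (continuous_apply i)) (isClosed_eq ?_ continuous_const)
    exact continuous_finsetSum _ fun i _ => (continuous_apply i).matrix_trace
  · refine (Metric.isBounded_closedBall (x := 0) (r := 1)).subset ?_
    rintro ω ⟨hω, hω1⟩
    rw [mem_closedBall_zero_iff, pi_norm_le_iff_of_nonneg zero_le_one]
    intro i
    rw [Matrix.norm_le_iff zero_le_one]
    intro j k
    refine ((hω i).norm_apply_le_re_trace j k).trans ?_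
    have h := congrArg Complex.re hω1
    rw [Complex.re_sum, Complex.one_re] at h
    rw [← h]
    exact Finset.single_le_sum (f := fun i => (ω i).trace.re)
      (fun i _ => (Complex.nonneg_iff.mp (hω i).trace_nonneg).1) (Finset.mem_univ i)

lemma trace_mul_im_eq_zero {A B : Matrix l l ℂ} (hA : A.IsHermitian) (hB : B.IsHermitian) :
    (A * B).trace.im = 0 := by
  rw [← Complex.conj_eq_iff_im, ← Complex.star_def, ← Matrix.trace_conjTranspose,
    Matrix.conjTranspose_mul, hA.eq, hB.eq, Matrix.trace_mul_comm]

/-- Real-linear functionals on Hermitian matrices are given by the trace pairing with a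
Hermitian matrix. -/
lemma exists_isHermitian_trace_mul_eq (g : Matrix l l ℂ →ₗ[ℝ] ℝ) :
    ∃ H : Matrix l l ℂ, H.IsHermitian ∧
      ∀ X : Matrix l l ℂ, X.IsHermitian → (H * X).trace = g X := by
  classical
  let A : Matrix l l ℂ := Matrix.of fun k s =>
    (g (Matrix.single s k 1) : ℂ) - Complex.I * g (Matrix.single s k Complex.I)
  have hre (X : Matrix l l ℂ) : (A * X).trace.re = g X := by
    conv_rhs => rw [Matrix.matrix_eq_sum_single X]
    have hsingle (s k : l) (z : ℂ) : g (Matrix.single s k z) =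
        z.re * g (Matrix.single s k 1) + z.im * g (Matrix.single s k Complex.I) := by
      have hz : Matrix.single s k z = z.re • Matrix.single s k (1 : ℂ) +
          z.im • Matrix.single s k Complex.I := by
        rw [Matrix.smul_single, Matrix.smul_single, ← Matrix.single_add]
        congr 1
        simp
      rw [hz, map_add, map_smul, map_smul, smul_eq_mul, smul_eq_mul]
    simp only [map_sum]
    rw [Finset.sum_comm]
    simp only [Matrix.trace, Matrix.diag_apply, Matrix.mul_apply, Complex.re_sum]
    refine Finset.sum_congr rfl fun k _ => Finset.sum_congr rfl fun s _ => ?_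
    rw [hsingle]
    simp only [A, Matrix.of_apply, Complex.mul_re, Complex.sub_re, Complex.sub_im, Complex.mul_im,
      Complex.ofReal_re, Complex.ofReal_im, Complex.I_re, Complex.I_im]
    ring
  have hH : ((2⁻¹ : ℝ) • (A + Aᴴ)).IsHermitian := by
    rw [Matrix.IsHermitian, Matrix.conjTranspose_smul, Matrix.conjTranspose_add,
      Matrix.conjTranspose_conjTranspose, add_comm, star_trivial]
  refine ⟨_, hH, fun X hX => Complex.ext ?_ ?_⟩
  · have hadj : (Aᴴ * X).trace.re = (A * X).trace.re := by
      rw [← Complex.conj_re, ← Complex.star_def, ← Matrix.trace_conjTranspose,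
        Matrix.conjTranspose_mul, Matrix.conjTranspose_conjTranspose, hX.eq,
        Matrix.trace_mul_comm]
    rw [Matrix.smul_mul, Matrix.trace_smul, Complex.smul_re, Matrix.add_mul, Matrix.trace_add,
      Complex.add_re, hadj, hre, Complex.ofReal_re, smul_eq_mul]
    ring
  · rw [trace_mul_im_eq_zero hH hX, Complex.ofReal_im]

variable {ι α : Type*} [Fintype ι] [Fintype α] [DecidableEq ι] [DecidableEq α]

/-- The map sending a family indexed by multi-indices to its marginals. -/
def marginals {M : Type*} [AddCommMonoid M] [Module ℝ M] :
    ((ι → α) → M) →ₗ[ℝ] ι → α → M :=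
  LinearMap.pi fun x => LinearMap.pi fun a =>
    ∑ i : ι → α, if i x = a then LinearMap.proj i else 0

lemma marginals_apply {M : Type*} [AddCommMonoid M] [Module ℝ M] (ω : (ι → α) → M)
    (x : ι) (a : α) :
    marginals ω x a = ∑ i, if i x = a then ω i else 0 := by
  simp only [marginals, LinearMap.pi_apply, LinearMap.sum_apply]
  refine Finset.sum_congr rfl fun i _ => ?_
  split_ifs <;> simp

lemma marginals_single {M : Type*} [AddCommMonoid M] [Module ℝ M] (i : ι → α) (P : M)
    (x : ι) (a : α) :
    marginals (Pi.single i P) x a = if a = i x then P else 0 := by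
  rw [marginals_apply, Finset.sum_eq_single i]
  · simp [eq_comm]
  · intro j _ hj
    simp [hj]
  · simp

/-- An additive family paired with any family depends only on the marginals of the latter. -/
lemma sum_pairing_eq_sum_marginals {R M N : Type*} [CommSemiring R] [AddCommMonoid M] [Module R M]
    [AddCommMonoid N] [Module R N] (β : M →ₗ[R] M →ₗ[R] N) (B ρ : ι → α → M)
    (ω : (ι → α) → M) (hω : ∀ x a, ∑ i, (if i x = a then ω i else 0) = ρ x a) :
    ∑ i, β (∑ x, B x (i x)) (ω i) = ∑ x, ∑ a, β (B x a) (ρ x a) := by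
  simp only [map_sum, LinearMap.sum_apply]
  rw [Finset.sum_comm]
  refine Finset.sum_congr rfl fun x _ => ?_
  simp only [← hω, map_sum]
  rw [Finset.sum_comm]
  refine Finset.sum_congr rfl fun i _ => ?_
  rw [Finset.sum_eq_single (i x)]
  · simp
  · intro a _ ha
    simp [ha.symm]
  · simp

/-- A family of Hermitian matrices with unit marginal trace that is not the marginal family of
positive semidefinite matrices is separated by an additive positive definite family. -/
lemma exists_posDef_separating [Nonempty ι] (σ : ι → α → Matrix l l ℂ)
    (hσ : ∀ x a, (σ x a).IsHermitian) (htr : ∀ x, ∑ a, (σ x a).trace = 1)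
    (hsteer : ¬ ∃ ω : (ι → α) → Matrix l l ℂ, (∀ i, (ω i).PosSemidef) ∧ marginals ω = σ) :
    ∃ B : ι → α → Matrix l l ℂ, (∀ x a, (B x a).IsHermitian) ∧
      (∀ i : ι → α, (∑ x, B x (i x)).PosDef) ∧ ∑ x, ∑ a, (B x a * σ x a).trace < 0 := by
  classical
  have : LocallyConvexSpace ℝ (Matrix l l ℂ) :=
    inferInstanceAs (LocallyConvexSpace ℝ (l → l → ℂ))
  obtain ⟨f, u, hfσ, hfu⟩ := geometric_hahn_banach_point_closed
    (E := ι → α → Matrix l l ℂ) (x := σ)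
    (t := marginals '' psdFamilies (ι → α) l)
    ((convex_psdFamilies _).linear_image _)
    ((isCompact_psdFamilies _).image (LinearMap.continuous_of_finiteDimensional _)).isClosed
    (fun ⟨ω, hω, h⟩ => hsteer ⟨ω, hω.1, h⟩)
  choose H hH hHf using fun x a => exists_isHermitian_trace_mul_eq
    (f.toLinearMap ∘ₗ LinearMap.single ℝ (fun _ : ι => α → Matrix l l ℂ) x ∘ₗ
      LinearMap.single ℝ (fun _ : α => Matrix l l ℂ) a)
  have hf (X : ι → α → Matrix l l ℂ) (hX : ∀ x a, (X x a).IsHermitian) :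
      ∑ x, ∑ a, (H x a * X x a).trace = f X := by
    simp only [hHf _ _ _ (hX _ _), LinearMap.comp_apply, LinearMap.coe_single]
    norm_cast
    simp only [← map_sum]
    congr 1
    refine Eq.trans (Finset.sum_congr rfl fun x _ => ?_) (Finset.univ_sum_single X)
    simp only [← LinearMap.coe_single ℝ (fun _ : ι => α → Matrix l l ℂ)]
    rw [← map_sum, Finset.univ_sum_single]
  let c : ℝ := u / Fintype.card ι
  have hcard : (Fintype.card ι : ℝ) * c = u := by
    simp only [c]
    field_simp
  have hc : (c • (1 : Matrix l l ℂ)).IsHermitian := by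
    simp [Matrix.IsHermitian, Matrix.conjTranspose_smul]
  have hB (x : ι) (a : α) : (H x a - c • (1 : Matrix l l ℂ)).IsHermitian := (hH x a).sub hc
  refine ⟨fun x a => H x a - c • (1 : Matrix l l ℂ), hB, fun i => ?_, ?_⟩
  · have hZ : ∑ x, (H x (i x) - c • (1 : Matrix l l ℂ)) =
        ∑ x, H x (i x) - u • (1 : Matrix l l ℂ) := by
      rw [Finset.sum_sub_distrib, Finset.sum_const, Finset.card_univ, ← Nat.cast_smul_eq_nsmul ℝ,
        smul_smul, hcard]
    rw [Matrix.posDef_iff_dotProduct_mulVec]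
    refine ⟨isSelfAdjoint_sum _ fun x _ => hB x (i x), fun v hv => ?_⟩
    let P := Matrix.vecMulVec v (star v)
    have hP : P.PosSemidef := Matrix.posSemidef_vecMulVec_self_star v
    have hPtr : P.trace = star v ⬝ᵥ v := by
      rw [Matrix.trace_vecMulVec, dotProduct_comm]
    obtain ⟨N, hN, hNv⟩ : ∃ N : ℝ, 0 < N ∧ (N : ℂ) = star v ⬝ᵥ v := by
      have h := dotProduct_star_self_pos_iff.mpr hv
      rw [Complex.pos_iff] at h
      exact ⟨_, h.1, Complex.ext (Complex.ofReal_re _) ((Complex.ofReal_im _).trans h.2)⟩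
    have hω : Pi.single i (N⁻¹ • P) ∈ psdFamilies (ι → α) l := by
      refine ⟨fun j => ?_, ?_⟩
      · obtain rfl | hj := eq_or_ne j i
        · rw [Pi.single_eq_same]
          exact hP.smul (inv_nonneg.mpr hN.le)
        · rw [Pi.single_eq_of_ne hj]
          exact Matrix.PosSemidef.zero
      · rw [Finset.sum_eq_single i (fun j _ hj => by rw [Pi.single_eq_of_ne hj, Matrix.trace_zero])
          (by simp), Pi.single_eq_same, Matrix.trace_smul, hPtr, ← hNv, Complex.real_smul]
        norm_cast
        exact inv_mul_cancel₀ hN.ne'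
    have hu := hfu _ ⟨_, hω, rfl⟩
    have hval : ((f (marginals (Pi.single i (N⁻¹ • P))) : ℝ) : ℂ) =
        N⁻¹ • ((∑ x, H x (i x)) * P).trace := by
      rw [← hf]
      · simp only [marginals_single, mul_ite, mul_zero, apply_ite Matrix.trace, Matrix.trace_zero,
          Finset.sum_ite_eq', Finset.mem_univ, if_true, Matrix.mul_smul, Matrix.trace_smul,
          ← Finset.smul_sum, Finset.sum_mul, Matrix.trace_sum]
      · intro x a
        rw [marginals_single]
        split_ifs
        · exact (hP.smul (inv_nonneg.mpr hN.le)).isHermitian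
        · exact Matrix.isHermitian_zero
    have hquad : star v ⬝ᵥ ((∑ x, (H x (i x) - c • (1 : Matrix l l ℂ))) *ᵥ v) =
        ((N * (f (marginals (Pi.single i (N⁻¹ • P))) - u) : ℝ) : ℂ) := by
      push_cast
      rw [hval, hZ, mul_sub, Complex.real_smul, ← mul_assoc, Complex.ofReal_inv,
        mul_inv_cancel₀ (by exact_mod_cast hN.ne'), one_mul, Matrix.mul_vecMulVec,
        Matrix.trace_vecMulVec, Matrix.sub_mulVec, dotProduct_sub, Matrix.smul_mulVec,
        Matrix.one_mulVec, dotProduct_smul, ← hNv, Complex.real_smul, dotProduct_comm,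
        mul_comm (u : ℂ)]
    rw [hquad]
    exact_mod_cast mul_pos hN (sub_pos.mpr hu)
  · have : ∑ x, ∑ a, ((H x a - c • (1 : Matrix l l ℂ)) * σ x a).trace = ((f σ - u : ℝ) : ℂ) := by
      simp only [Matrix.sub_mul, Matrix.trace_sub, Finset.sum_sub_distrib, hf σ hσ, Matrix.smul_mul,
        Matrix.one_mul, Matrix.trace_smul, ← Finset.smul_sum, htr]
      rw [← hcard]
      simp [mul_comm]
    rw [this]
    exact_mod_cast sub_neg.mpr hfσ

end Duality

/-- An additive functional that is positive on every multi-index is positive on normalized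
nonnegative marginals. -/
lemma sum_mul_pos_of_forall_sum_pos {ι α : Type*} [Fintype ι] [Fintype α] [Nonempty α]
    {b p : ι → α → ℝ} (hb : ∀ i : ι → α, 0 < ∑ x, b x (i x))
    (hp : ∀ x a, 0 ≤ p x a) {s : ℝ} (hs : 0 < s) (hps : ∀ x, ∑ a, p x a = s) :
    0 < ∑ x, ∑ a, b x a * p x a := by
  choose i hi using fun x => Finite.exists_min (b x)
  calc 0 < (∑ x, b x (i x)) * s := mul_pos (hb i) hs
    _ = ∑ x, ∑ a, b x (i x) * p x a := by simp only [Finset.sum_mul, ← Finset.mul_sum, hps]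
    _ ≤ _ := Finset.sum_le_sum fun x _ => Finset.sum_le_sum fun a _ =>
      mul_le_mul_of_nonneg_right (hi x a) (hp x a)

lemma steeringRel_sum {n m d : ℕ} (B : Fin n → Fin m → Matrix (Fin d) (Fin d) ℂ) :
    SteeringRel fun i => ∑ x, B x (i x) := by
  intro i j
  have h (x : Fin n) : ∑ y, B y (Function.update j x (i x) y) =
      ∑ y, B y (j y) + (B x (i x) - B x (j x)) := by
    rw [← sub_eq_iff_eq_add', ← Finset.sum_sub_distrib, Finset.sum_eq_single x]
    · simp
    · intro y _ hy
      simp [hy]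
    · simp
  simp only [h, Finset.sum_add_distrib, Finset.sum_const, Finset.card_univ, Fintype.card_fin,
    Finset.sum_sub_distrib, sub_smul,
      Nat.cast_smul_eq_nsmul, one_smul]
  abel

lemma sum_ite_single_slot {ι α M : Type*} [Fintype ι] [Fintype α] [DecidableEq ι] [DecidableEq α]
    [AddCommMonoid M] (b : α) (y : ι) (F : (ι → α) → M) :
    ∑ i : ι → α, (if i y ≠ b ∧ ∀ z, z ≠ y → i z = b then F i else 0) =
      ∑ a, if a ≠ b then F (Function.update (fun _ => b) y a) else 0 := by
  rw [← Finset.sum_filter, ← Finset.sum_filter]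
  symm
  refine Finset.sum_bij' (fun a _ => Function.update (fun _ => b) y a) (fun i _ => i y)
    ?_ ?_ ?_ ?_ ?_
  · intro a ha
    simp_all
  · intro i hi
    simp_all
  · simp
  · intro i hi
    ext z
    obtain rfl | hz := eq_or_ne z y
    · simp
    · simp_all
  · simp

lemma sum_wspec_eq {n m d : ℕ} (hm : 0 < m) (ρ : Fin n → Fin m → Matrix (Fin d) (Fin d) ℂ)
    (ρbar : Matrix (Fin d) (Fin d) ℂ) (hρbar : ∀ x, ∑ a, ρ x a = ρbar) (x : Fin n) (a : Fin m) :
    ∑ i : Fin n → Fin m, (if i x = a then wspec hm ρ ρbar i else 0) = ρ x a := by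
  set b := lastIdx hm
  have hslot (y : Fin n) : ∑ i : Fin n → Fin m, (if i x = a then
      (if i y ≠ b ∧ ∀ z, z ≠ y → i z = b then ρ y (i y) else 0) else 0) =
      if y = x then (if a = b then 0 else ρ x a) else if a = b then ρbar - ρ y b else 0 := by
    have hcomm (i : Fin n → Fin m) : (if i x = a then
        (if i y ≠ b ∧ ∀ z, z ≠ y → i z = b then ρ y (i y) else 0) else 0) =
        if i y ≠ b ∧ ∀ z, z ≠ y → i z = b then (if i x = a then ρ y (i y) else 0) else 0 := by
      split_ifs <;> rfl
    simp only [hcomm]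
    trans ∑ c, if c ≠ b then (if Function.update (fun _ => b) y c x = a then
        ρ y (Function.update (fun _ => b) y c y) else 0) else 0
    · convert sum_ite_single_slot b y fun i => if i x = a then ρ y (i y) else 0
    split_ifs with hyx hab hab
    · subst hyx hab
      exact Finset.sum_eq_zero fun c _ => by simp +contextual
    · subst hyx
      rw [Finset.sum_eq_single a (fun c _ hc => by simp [hc]) (by simp)]
      simp [hab]
    · subst hab
      have hne : x ≠ y := fun h => hyx h.symm
      simp only [Function.update_of_ne hne, Function.update_self, if_true]
      rw [← hρbar y, eq_sub_iff_add_eq, ← Finset.sum_filter, Finset.filter_ne',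
        Finset.sum_erase_add _ _ (Finset.mem_univ b)]
    · have hne : x ≠ y := fun h => hyx h.symm
      exact Finset.sum_eq_zero fun c _ => by simp [Function.update_of_ne hne, Ne.symm hab]
  have hcorner (W : Matrix (Fin d) (Fin d) ℂ) : ∑ i : Fin n → Fin m, (if i x = a then
      (if ∀ z, i z = b then W else 0) else 0) = if a = b then W else 0 := by
    rw [Finset.sum_eq_single fun _ => b]
    · simp [eq_comm]
    · intro i _ hi
      have : ¬ ∀ z, i z = b := fun h => hi (funext h)
      simp [this]
    · simp
  have hsplit (i : Fin n → Fin m) : (if i x = a then wspec hm ρ ρbar i else 0) =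
      (if i x = a then (if ∀ z, i z = b then
        (∑ x : Fin n, ρ x b) - ((n : ℂ) - 1) • ρbar else 0) else 0) +
      ∑ y, if i x = a then
        (if i y ≠ b ∧ ∀ z, z ≠ y → i z = b then ρ y (i y) else 0) else 0 := by
    rw [wspec]
    split_ifs <;> simp [b]
  simp only [hsplit, Finset.sum_add_distrib]
  rw [Finset.sum_comm, hcorner]
  simp only [hslot]
  split_ifs with hab
  · subst hab
    have hy (y : Fin n) : (if y = x then (0 : Matrix (Fin d) (Fin d) ℂ) else ρbar - ρ y b) =
        (ρbar - ρ y b) - if y = x then ρbar - ρ x b else 0 := by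
      split_ifs with h
      · rw [h, sub_self]
      · rw [sub_zero]
    simp only [if_true, hy, Finset.sum_sub_distrib, Finset.sum_const, Finset.card_univ,
      Fintype.card_fin, Finset.sum_ite_eq', Finset.mem_univ, if_true, sub_smul,
      Nat.cast_smul_eq_nsmul, one_smul]
    abel
  · simp

/-- every steerable ensemble is detected by some positive semidefinite
family `Z` satisfying the steering-map relations, normalized so that
`tr(Σ_AB) = Σ_i tr(Z_i)·tr(ω^spec_i) = 1`, via a negative swap-witness value
`Σ_i tr(Z_i · ω^spec_i) < 0`. -/
theorem stmt1 (n m d : ℕ) (hn : 1 ≤ n) (hm : 2 ≤ m) (hd : 1 ≤ d)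
    (ρ : Fin n → Fin m → Matrix (Fin d) (Fin d) ℂ)
    (hρ : ∀ x a, (ρ x a).PosSemidef)
    (ρbar : Matrix (Fin d) (Fin d) ℂ)
    (hρbar : ∀ x, ∑ a, ρ x a = ρbar)
    (hsteer : ¬ ∃ ω : (Fin n → Fin m) → Matrix (Fin d) (Fin d) ℂ,
        (∀ i, (ω i).PosSemidef) ∧
        ∀ x a, ρ x a = ∑ i : Fin n → Fin m, if i x = a then ω i else 0) :
    ∃ Z : (Fin n → Fin m) → Matrix (Fin d) (Fin d) ℂ,
      (∀ i, (Z i).PosSemidef) ∧ SteeringRel Z ∧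
      (∑ i : Fin n → Fin m, (Z i).trace * (wspec (by omega) ρ ρbar i).trace) = 1 ∧
      (∑ i : Fin n → Fin m, (Z i * wspec (by omega) ρ ρbar i).trace) < 0 := by
  have : NeZero n := ⟨by omega⟩
  have : NeZero m := ⟨by omega⟩
  have : NeZero d := ⟨by omega⟩
  have hρbar_psd : ρbar.PosSemidef := hρbar 0 ▸ Matrix.posSemidef_sum _ fun a _ => hρ 0 a
  obtain ⟨s, hs⟩ : ∃ s : ℝ, (s : ℂ) = ρbar.trace :=
    ⟨_, Complex.ext (Complex.ofReal_re _)
      ((Complex.nonneg_iff.mp hρbar_psd.trace_nonneg).2 ▸ Complex.ofReal_im _)⟩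
  have hspos : 0 < s := by
    have h0 : 0 ≤ s := by exact_mod_cast hs ▸ hρbar_psd.trace_nonneg
    refine h0.lt_of_ne' fun h => hsteer ⟨0, fun _ => Matrix.PosSemidef.zero, fun x a => ?_⟩
    have htr : ∑ a, (ρ x a).trace = 0 := by
      rw [← Matrix.trace_sum, hρbar, ← hs, h, Complex.ofReal_zero]
    have := (Finset.sum_eq_zero_iff_of_nonneg fun a _ => (hρ x a).trace_nonneg).mp htr a
      (Finset.mem_univ a)
    simp [(hρ x a).trace_eq_zero_iff.mp this]
  obtain ⟨B, hB, hZ, hneg⟩ := exists_posDef_separating (fun x a => s⁻¹ • ρ x a)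
    (fun x a => ((hρ x a).smul (inv_nonneg.mpr hspos.le)).isHermitian)
    (fun x => by
      simp only [Matrix.trace_smul]
      rw [← Finset.smul_sum, ← Matrix.trace_sum, hρbar, ← hs, Complex.real_smul]
      norm_cast
      exact inv_mul_cancel₀ hspos.ne')
    (fun ⟨ω, hω, h⟩ => hsteer ⟨s • ω, fun i => (hω i).smul hspos.le, fun x a => by
      rw [← marginals_apply, map_smul, h]
      simp [smul_smul, hspos.ne']⟩)
  have hneg' : ∑ x, ∑ a, (B x a * ρ x a).trace < 0 := by
    simp only [Matrix.mul_smul, Matrix.trace_smul, ← Finset.smul_sum] at hneg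
    exact (smul_neg_iff_of_pos_left (inv_pos.mpr hspos)).mp hneg
  have hreal {A : Matrix (Fin d) (Fin d) ℂ} (hA : A.IsHermitian) : (A.trace.re : ℂ) = A.trace :=
    Complex.conj_eq_iff_re.mp (by rw [← Complex.star_def, ← Matrix.trace_conjTranspose, hA.eq])
  obtain ⟨t, ht, htB⟩ : ∃ t : ℝ, 0 < t ∧ ∑ x, ∑ a, (B x a).trace * (ρ x a).trace = (t : ℂ) := by
    refine ⟨_, sum_mul_pos_of_forall_sum_pos (b := fun x a => (B x a).trace.re)
      (p := fun x a => (ρ x a).trace.re) (fun i => ?_)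
      (fun x a => (Complex.nonneg_iff.mp (hρ x a).trace_nonneg).1) hspos (fun x => ?_), ?_⟩
    · rw [← Complex.re_sum, ← Matrix.trace_sum]
      exact (Complex.pos_iff.mp (hZ i).trace_pos).1
    · rw [← Complex.re_sum, ← Matrix.trace_sum, hρbar, ← hs, Complex.ofReal_re]
    · push_cast
      simp only [hreal (hB _ _), hreal (hρ _ _).isHermitian]
  have hw := sum_wspec_eq (by omega) ρ ρbar hρbar
  have hpair (β : Matrix (Fin d) (Fin d) ℂ →ₗ[ℂ] Matrix (Fin d) (Fin d) ℂ →ₗ[ℂ] ℂ) :=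
    sum_pairing_eq_sum_marginals β (fun x a => t⁻¹ • B x a) ρ _ hw
  refine ⟨fun i => ∑ x, t⁻¹ • B x (i x), fun i => ?_,
    steeringRel_sum fun x a => t⁻¹ • B x a, ?_, ?_⟩
  · simp only [← Finset.smul_sum]
    exact (hZ i).posSemidef.smul (inv_nonneg.mpr ht.le)
  · refine (hpair ((LinearMap.mul ℂ ℂ).compl₁₂ (Matrix.traceLinearMap (Fin d) ℂ ℂ)
      (Matrix.traceLinearMap (Fin d) ℂ ℂ))).trans ?_
    simp only [LinearMap.compl₁₂_apply, LinearMap.mul_apply', Matrix.traceLinearMap_apply,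
      Matrix.trace_smul, smul_mul_assoc, ← Finset.smul_sum, htB]
    rw [Complex.real_smul]
    norm_cast
    exact inv_mul_cancel₀ ht.ne'
  · refine (hpair ((LinearMap.mul ℂ (Matrix (Fin d) (Fin d) ℂ)).compr₂
      (Matrix.traceLinearMap (Fin d) ℂ ℂ))).trans_lt ?_
    simp only [LinearMap.compr₂_apply, LinearMap.mul_apply', Matrix.traceLinearMap_apply,
      Matrix.trace_smul, smul_mul_assoc, ← Finset.smul_sum]
    exact (smul_neg_iff_of_pos_left (inv_pos.mpr ht)).mpr hneg'
end

section
/- Let n ≥ 1, m ≥ 2, n_B ≥ 1, d_A ≥ 1, d_B ≥ 1 with n_B > √(d_A·d_B) − 1. Let {ω_i}, i ∈ {1,…,m}^n, be positive semidefinite d_B×d_B matrices, let {Z_i} be positive semidefinite d_A×d_A matrices, and assume the normalization Σ_i tr(Z_i)·tr(ω_i) = 1. For y = 1,…,n_B let M_{+|y}, M_{−|y} be positive semidefinite d_B×d_B matrices with M_{+|y} + M_{−|y} = I; set B_0 = I and B_y = M_{+|y} − M_{−|y}. Let G_0,…,G_{n_B} be Hermitian d_A×d_A matrices with tr(G_k·G_l)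 = δ_{kl} and such that the identity matrix I_{d_A} lies in the real linear span of {G_0,…,G_{n_B}}. Let D be the real (n_B+1)×(n_B+1) matrix with entries D_{ky} = Σ_i tr(G_k·Z_i)·tr(B_y·ω_i). Then |det D| ≤ (1/√d_A)·((√(d_A·d_B) − 1)/(n_B·√d_A))^{n_B}. -/
open Matrix Finset
open scoped ComplexOrder

open scoped MatrixOrder in
theorem Matrix.PosSemidef.exists_eq_transpose_mul_self {k : Type*} [Fintype k]
    {A : Matrix k k ℝ} (hA : A.PosSemidef) : ∃ K : Matrix k k ℝ, A = Kᵀ * K := by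
  classical
  obtain ⟨K, hK⟩ := CStarAlgebra.nonneg_iff_eq_star_mul_self.mp hA.nonneg
  exact ⟨K, by rw [hK, star_eq_conjTranspose, conjTranspose_eq_transpose_of_trivial]⟩

theorem Real.prod_le_sum_div_card_pow {k : Type*} [Fintype k] [Nonempty k] (z : k → ℝ)
    (hz : ∀ i, 0 ≤ z i) : ∏ i, z i ≤ ((∑ i, z i) / Fintype.card k) ^ Fintype.card k := by
  have hk : Fintype.card k ≠ 0 := Fintype.card_ne_zero
  have h := Real.geom_mean_le_arith_mean univ (fun _ => (1 : ℝ)) z (by simp)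
    (by simp [Fintype.card_pos]) (fun i _ => hz i)
  simp only [Real.rpow_one, one_mul, sum_const, card_univ, nsmul_eq_mul, mul_one] at h
  have hp : 0 ≤ ∏ i, z i := prod_nonneg fun i _ => hz i
  calc ∏ i, z i = ((∏ i, z i) ^ ((Fintype.card k : ℝ)⁻¹)) ^ Fintype.card k :=
        (Real.rpow_inv_natCast_pow hp hk).symm
    _ ≤ _ := pow_le_pow_left₀ (Real.rpow_nonneg hp _) h _

theorem Matrix.PosSemidef.det_le_trace_div_card_pow {k : Type*} [Fintype k] [DecidableEq k]
    [Nonempty k] {A : Matrix k k ℝ} (hA : A.PosSemidef) :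
    A.det ≤ (A.trace / Fintype.card k) ^ Fintype.card k := by
  rw [hA.isHermitian.det_eq_prod_eigenvalues, hA.isHermitian.trace_eq_sum_eigenvalues]
  exact Real.prod_le_sum_div_card_pow _ hA.eigenvalues_nonneg

theorem Matrix.PosSemidef.mul_mul_transpose_same {k l : Type*} [Fintype k] [Fintype l]
    {A : Matrix k k ℝ} (hA : A.PosSemidef) (K : Matrix l k ℝ) : (K * A * Kᵀ).PosSemidef := by
  simpa [conjTranspose_eq_transpose_of_trivial] using hA.mul_mul_conjTranspose_same K

theorem Matrix.posSemidef_self_mul_transpose {k l : Type*} [Fintype k] [Fintype l]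
    (X : Matrix k l ℝ) : (X * Xᵀ).PosSemidef := by
  simpa [conjTranspose_eq_transpose_of_trivial] using posSemidef_self_mul_conjTranspose X

/-- The arithmetic-geometric mean inequality for the eigenvalues of `A` relative to `Γ`. -/
theorem Matrix.PosDef.det_le_of_posSemidef {k : Type*} [Fintype k] [DecidableEq k] [Nonempty k]
    {Γ A : Matrix k k ℝ} (hΓ : Γ.PosDef) (hA : A.PosSemidef) :
    A.det ≤ Γ.det * ((A * Γ⁻¹).trace / Fintype.card k) ^ Fintype.card k := by
  obtain ⟨K, hK⟩ := hΓ.inv.posSemidef.exists_eq_transpose_mul_self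
  have h := (hA.mul_mul_transpose_same K).det_le_trace_div_card_pow
  have hdet : K.det * K.det = Γ.det⁻¹ := by
    rw [← Ring.inverse_eq_inv', ← det_nonsing_inv, hK, det_mul, det_transpose]
  have htr : (K * A * Kᵀ).trace = (A * Γ⁻¹).trace := by
    rw [trace_mul_comm, ← Matrix.mul_assoc, ← hK, trace_mul_comm]
  rw [det_mul, det_mul, det_transpose, mul_right_comm, hdet, htr] at h
  rwa [inv_mul_le_iff₀ hΓ.det_pos] at h

theorem Matrix.PosDef.det_le_det {k : Type*} [Fintype k] [DecidableEq k] [Nonempty k]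
    {A S : Matrix k k ℝ} (hA : A.PosDef) (hS : S.PosSemidef) (hAS : (A - S).PosSemidef) :
    S.det ≤ A.det := by
  refine (hA.det_le_of_posSemidef hS).trans (mul_le_of_le_one_right hA.det_pos.le ?_)
  obtain ⟨K, hK⟩ := hA.inv.posSemidef.exists_eq_transpose_mul_self
  have htr (T : Matrix k k ℝ) : (K * T * Kᵀ).trace = (T * A⁻¹).trace := by
    rw [trace_mul_comm, ← Matrix.mul_assoc, ← hK, trace_mul_comm]
  have h0 := (hS.mul_mul_transpose_same K).trace_nonneg
  have h1 := (hAS.mul_mul_transpose_same K).trace_nonneg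
  rw [htr] at h0 h1
  rw [Matrix.sub_mul, trace_sub, mul_nonsing_inv _ ((isUnit_iff_isUnit_det _).1 hA.isUnit),
    trace_one] at h1
  have hk : (0 : ℝ) < Fintype.card k := by exact_mod_cast Fintype.card_pos
  exact pow_le_one₀ (by positivity) ((div_le_one hk).2 (by linarith))

theorem Matrix.det_mul_transpose_sq_le {k l : Type*} [Fintype k] [DecidableEq k] [Nonempty k]
    [Fintype l] (X Y : Matrix k l ℝ) :
    (X * Yᵀ).det ^ 2 ≤ (X * Xᵀ).det * (Y * Yᵀ).det := by
  have key (X Y : Matrix k l ℝ) (h : (X * Xᵀ).det = 0) : (X * Yᵀ).det = 0 := by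
    obtain ⟨v, hv, hv0⟩ := exists_vecMul_eq_zero_iff.2 h
    refine exists_vecMul_eq_zero_iff.1 ⟨v, hv, ?_⟩
    have : v ᵥ* X = 0 := by
      rw [← vecMul_self_mul_conjTranspose_eq_zero X v, conjTranspose_eq_transpose_of_trivial]
      exact hv0
    rw [← vecMul_vecMul, this, zero_vecMul]
  by_cases hX : (X * Xᵀ).det = 0
  · simp [key X Y hX, hX]
  by_cases hY : (Y * Yᵀ).det = 0
  · have := key Y X hY
    rw [← det_transpose, transpose_mul, transpose_transpose] at this
    simp [this, hY]
  have hXp := (posSemidef_self_mul_transpose X).posDef_iff_det_ne_zero.2 hX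
  have hYp := (posSemidef_self_mul_transpose Y).posDef_iff_det_ne_zero.2 hY
  set Q := (Y * Yᵀ)⁻¹ with hQ
  have hQt : Qᵀ = Q := by rw [hQ, transpose_nonsing_inv, transpose_mul, transpose_transpose]
  have hQY : Q * (Y * Yᵀ) = 1 := nonsing_inv_mul _ (isUnit_iff_ne_zero.2 hY)
  have h := hXp.det_le_det (hYp.inv.posSemidef.mul_mul_transpose_same (X * Yᵀ)) (by
    have h := posSemidef_self_mul_transpose (X - X * Yᵀ * Q * Y)
    convert h using 1
    simp only [transpose_sub, transpose_mul, transpose_transpose, hQt, Matrix.sub_mul,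
      Matrix.mul_sub, ← hQ]
    have : X * Yᵀ * Q * Y * (Yᵀ * (Q * (Y * Xᵀ))) = X * Yᵀ * Q * (Y * Xᵀ) := by
      calc _ = X * Yᵀ * (Q * (Y * Yᵀ)) * (Q * (Y * Xᵀ)) := by simp only [Matrix.mul_assoc]
        _ = _ := by rw [hQY]; simp only [Matrix.mul_one, Matrix.mul_assoc]
    rw [this]
    simp only [Matrix.mul_assoc]
    abel)
  rw [det_mul, det_mul, det_transpose, det_nonsing_inv, Ring.inverse_eq_inv'] at h
  have hp := hYp.det_pos
  calc _ = (X * Yᵀ).det * (Y * Yᵀ).det⁻¹ * (X * Yᵀ).det * (Y * Yᵀ).det := by field_simp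
    _ ≤ _ := by gcongr

theorem Matrix.PosDef.det_le_of_dotProduct {n : ℕ} (hn : 1 ≤ n) {d : ℝ} (hd : 1 ≤ d)
    {Γ M : Matrix (Fin (n + 1)) (Fin (n + 1)) ℝ} (hΓ : Γ.PosDef) (hM : M.PosSemidef)
    (c : Fin (n + 1) → ℝ) (hcΓ : c ⬝ᵥ Γ *ᵥ c = d) (hcM : c ⬝ᵥ M *ᵥ c = 1)
    (htr : (M * Γ⁻¹).trace ≤ 1) :
    M.det ≤ Γ.det * (1 / d) * ((1 - 1 / d) / n) ^ n := by
  have hd0 : 0 < d := by linarith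
  have hn0 : (0 : ℝ) < n := by exact_mod_cast hn
  have hd1 : 1 / d ≤ 1 := by rw [div_le_one hd0]; exact hd
  have main : ∀ ε : ℝ, 0 < ε →
      M.det ≤ Γ.det * (1 / d) * ((1 - 1 / d) / n + ε) ^ n := by
    intro ε hε
    set e := (1 - 1 / d) / n + ε with he
    have he0 : 0 < e := by
      have : 0 ≤ (1 - 1 / d) / n := div_nonneg (by linarith) hn0.le
      linarith
    have hne : 1 - 1 / d ≤ n * e := by
      rw [he, mul_add, mul_div_cancel₀ _ hn0.ne']
      have : 0 ≤ n * ε := by positivity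
      linarith
    set t := √(e * d) with ht
    have ht2 : t * t = e * d := Real.mul_self_sqrt (by positivity)
    set s := (t - 1) / d with hs
    have hsd : s * d = t - 1 := by rw [hs]; field_simp
    have hΓt : Γᵀ = Γ := by
      rw [← conjTranspose_eq_transpose_of_trivial]; exact hΓ.isHermitian
    have hΓu : IsUnit Γ.det := isUnit_iff_ne_zero.2 hΓ.det_pos.ne'
    set L : Matrix (Fin (n + 1)) (Fin (n + 1)) ℝ := 1 + s • vecMulVec (Γ *ᵥ c) c with hL
    have hLdet : L.det = t := by
      rw [hL, ← smul_vecMulVec, vecMulVec_eq Unit, det_one_add_replicateCol_mul_replicateRow]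
      simp only [dotProduct_smul, hcΓ, smul_eq_mul]
      linarith
    have hLL : Lᵀ * Γ⁻¹ * L = Γ⁻¹ + (e - 1 / d) • vecMulVec c c := by
      have h1 : Γ⁻¹ * L = Γ⁻¹ + s • vecMulVec c c := by
        rw [hL, Matrix.mul_add, Matrix.mul_one, Matrix.mul_smul, mul_vecMulVec, mulVec_mulVec,
          nonsing_inv_mul _ hΓu, one_mulVec]
      have h2 : Lᵀ = 1 + s • vecMulVec c (Γ *ᵥ c) := by
        rw [hL, transpose_add, transpose_one, transpose_smul, transpose_vecMulVec]
      have h3 : (Γ *ᵥ c) ᵥ* Γ⁻¹ = c := by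
        rw [← vecMul_transpose, hΓt, vecMul_vecMul, mul_nonsing_inv _ hΓu, vecMul_one]
      have h4 : s + s + s * (s * d) = e - 1 / d := by
        rw [hsd, hs]
        field_simp
        linear_combination ht2
      rw [Matrix.mul_assoc, h1, h2, Matrix.add_mul, Matrix.one_mul, Matrix.mul_add,
        Matrix.smul_mul, Matrix.smul_mul, vecMulVec_mul, h3, Matrix.mul_smul,
        vecMulVec_mul_vecMulVec, dotProduct_comm, hcΓ, ← h4, vecMulVec_smul]
      module
    have h := hΓ.det_le_of_posSemidef (hM.mul_mul_transpose_same L)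
    rw [det_mul, det_mul, det_transpose, hLdet, mul_right_comm, ht2] at h
    have htr' : (L * M * Lᵀ * Γ⁻¹).trace = (M * Γ⁻¹).trace + (e - 1 / d) := by
      calc _ = (M * (Lᵀ * Γ⁻¹ * L)).trace := by
            rw [Matrix.mul_assoc, Matrix.mul_assoc, trace_mul_comm, Matrix.mul_assoc]
        _ = _ := by
            rw [hLL, Matrix.mul_add, trace_add, Matrix.mul_smul, trace_smul, mul_vecMulVec,
              trace_vecMulVec, dotProduct_comm, hcM, smul_eq_mul, mul_one]
    have h0 : 0 ≤ (L * M * Lᵀ * Γ⁻¹).trace := by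
      obtain ⟨K, hK⟩ := hΓ.inv.posSemidef.exists_eq_transpose_mul_self
      have := ((hM.mul_mul_transpose_same L).mul_mul_transpose_same K).trace_nonneg
      rwa [trace_mul_comm, ← Matrix.mul_assoc, ← hK, trace_mul_comm] at this
    have hle : (L * M * Lᵀ * Γ⁻¹).trace / Fintype.card (Fin (n + 1)) ≤ e := by
      rw [Fintype.card_fin, div_le_iff₀ (by positivity), htr']
      push_cast
      linarith
    have h2 : e * d * M.det ≤ Γ.det * e ^ (n + 1) := by
      refine h.trans (mul_le_mul_of_nonneg_left ?_ hΓ.det_pos.le)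
      have := pow_le_pow_left₀ (by positivity) hle (n + 1)
      simpa only [Fintype.card_fin] using this
    have h3 : M.det ≤ Γ.det * e ^ (n + 1) / (e * d) := by
      rw [le_div_iff₀ (by positivity)]; linarith
    refine h3.trans_eq ?_
    field_simp
    ring
  have hlim : Filter.Tendsto (fun ε : ℝ => Γ.det * (1 / d) * ((1 - 1 / d) / n + ε) ^ n)
      (nhdsWithin 0 (Set.Ioi 0)) (nhds (Γ.det * (1 / d) * ((1 - 1 / d) / n) ^ n)) := by
    have : Continuous (fun ε : ℝ => Γ.det * (1 / d) * ((1 - 1 / d) / n + ε) ^ n) := by fun_prop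
    simpa using (this.tendsto 0).mono_left nhdsWithin_le_nhds
  exact ge_of_tendsto hlim (eventually_nhdsWithin_of_forall main)

theorem Matrix.PosSemidef.trace_mul_self_re_le {d : Type*} [Fintype d]
    {ρ : Matrix d d ℂ} (hρ : ρ.PosSemidef) : (ρ * ρ).trace.re ≤ ρ.trace.re ^ 2 := by
  classical
  have h1 : ρ.trace.re = ∑ i, hρ.1.eigenvalues i := by
    rw [hρ.1.trace_eq_sum_eigenvalues]; simp
  have h2 : (ρ * ρ).trace.re = ∑ i, hρ.1.eigenvalues i ^ 2 := by
    conv_lhs => rw [hρ.1.spectral_theorem, ← map_mul, Unitary.conjStarAlgAut_apply, trace_mul_cycle,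
      Unitary.coe_star_mul_self, one_mul, diagonal_mul_diagonal, trace_diagonal]
    simp [sq]
  rw [h1, h2]
  exact sum_sq_le_sq_sum_of_nonneg fun i _ => hρ.eigenvalues_nonneg i

theorem Matrix.PosSemidef.trace_mul_nonneg {d : Type*} [Fintype d]
    {A B : Matrix d d ℂ} (hA : A.PosSemidef) (hB : B.PosSemidef) : 0 ≤ (A * B).trace := by
  classical
  open scoped MatrixOrder in
  obtain ⟨K, hK⟩ := CStarAlgebra.nonneg_iff_eq_star_mul_self.mp hA.nonneg
  rw [hK, star_eq_conjTranspose, Matrix.mul_assoc, trace_mul_comm]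
  exact (hB.mul_mul_conjTranspose_same K).trace_nonneg

theorem Matrix.IsHermitian.trace_mul_self_re_nonneg {d : Type*} [Fintype d]
    {A : Matrix d d ℂ} (hA : A.IsHermitian) : 0 ≤ (A * A).trace.re := by
  have h := (posSemidef_conjTranspose_mul_self A).trace_nonneg
  rw [hA.eq] at h
  exact (Complex.le_def.1 h).1

theorem Matrix.IsHermitian.ofReal_trace_mul_re {d : Type*} [Fintype d]
    {A B : Matrix d d ℂ} (hA : A.IsHermitian) (hB : B.IsHermitian) :
    ((A * B).trace.re : ℂ) = (A * B).trace := by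
  rw [← Complex.conj_eq_iff_re, ← Complex.star_def, ← trace_conjTranspose, conjTranspose_mul,
    hA.eq, hB.eq, trace_mul_comm]

theorem isHermitian_sum_smul {k d : Type*} [Fintype k] {H : k → Matrix d d ℂ}
    (hH : ∀ i, (H i).IsHermitian) (x : k → ℝ) : (∑ i, (x i : ℂ) • H i).IsHermitian := by
  rw [IsHermitian, conjTranspose_sum]
  exact sum_congr rfl fun i _ => by rw [conjTranspose_smul, (hH i).eq]; simp

section HilbertSchmidt

variable {k d : Type*} [Fintype k] [Fintype d]

/-- The Gram matrix of a family of Hermitian matrices for the Hilbert–Schmidt inner product. -/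
def hsGram (H : k → Matrix d d ℂ) : Matrix k k ℝ := Matrix.of fun i j => (H i * H j).trace.re

theorem trace_sum_smul_mul_re (H : k → Matrix d d ℂ) (x : k → ℝ) (ρ : Matrix d d ℂ) :
    ((∑ i, (x i : ℂ) • H i) * ρ).trace.re = x ⬝ᵥ fun i => (H i * ρ).trace.re := by
  simp [Matrix.sum_mul, trace_sum, trace_smul, dotProduct]

theorem trace_sum_smul_mul_self_re (H : k → Matrix d d ℂ) (x : k → ℝ) :
    ((∑ i, (x i : ℂ) • H i) * ∑ i, (x i : ℂ) • H i).trace.re = x ⬝ᵥ hsGram H *ᵥ x := by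
  rw [trace_sum_smul_mul_re]
  congr 1
  ext i
  rw [trace_mul_comm, trace_sum_smul_mul_re, mulVec, dotProduct_comm]
  simp only [hsGram, of_apply, trace_mul_comm (H i)]

theorem hsGram_posSemidef {H : k → Matrix d d ℂ} (hH : ∀ i, (H i).IsHermitian) :
    (hsGram H).PosSemidef := by
  refine .of_dotProduct_mulVec_nonneg ?_ fun x => ?_
  · ext i j
    simp [hsGram, trace_mul_comm (H i)]
  · rw [star_trivial, ← trace_sum_smul_mul_self_re]
    exact (isHermitian_sum_smul hH x).trace_mul_self_re_nonneg

/-- Bessel's inequality for a family of Hermitian matrices which need not be orthonormal. -/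
theorem dotProduct_hsGram_inv_le [DecidableEq k] {H : k → Matrix d d ℂ}
    (hH : ∀ i, (H i).IsHermitian) (hΓ : (hsGram H).PosDef) {ρ : Matrix d d ℂ}
    (hρ : ρ.IsHermitian) {w : k → ℝ} (hw : ∀ i, w i = (H i * ρ).trace.re) :
    w ⬝ᵥ (hsGram H)⁻¹ *ᵥ w ≤ (ρ * ρ).trace.re := by
  set x := (hsGram H)⁻¹ *ᵥ w with hx
  set K := ∑ i, (x i : ℂ) • H i with hK
  have hKρ : (K * ρ).trace.re = w ⬝ᵥ x := by
    rw [hK, trace_sum_smul_mul_re, dotProduct_comm]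
    simp only [← hw]
  have hKK : (K * K).trace.re = w ⬝ᵥ x := by
    rw [hK, trace_sum_smul_mul_self_re]
    conv_lhs => rw [hx, mulVec_mulVec, mul_nonsing_inv _ (isUnit_iff_ne_zero.2 hΓ.det_pos.ne'),
      one_mulVec, dotProduct_comm]
  have h := (hρ.sub (isHermitian_sum_smul hH x)).trace_mul_self_re_nonneg
  rw [← hK, Matrix.sub_mul, Matrix.mul_sub, Matrix.mul_sub, trace_sub, trace_sub, trace_sub,
    trace_mul_comm ρ K] at h
  simp only [Complex.sub_re, hKρ, hKK] at h
  linarith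

end HilbertSchmidt

/-- Determinant bound for the second-moment matrix of the coordinates of positive semidefinite
matrices with respect to Hermitian matrices whose span contains the identity. -/
theorem det_mul_transpose_le_hsGram {ι : Type*} [Fintype ι] {n d : ℕ} (hn : 1 ≤ n) (hd : 1 ≤ d)
    {H : Fin (n + 1) → Matrix (Fin d) (Fin d) ℂ} (hH : ∀ k, (H k).IsHermitian)
    {c : Fin (n + 1) → ℝ} (hc : 1 = ∑ k, (c k : ℂ) • H k)
    {ρ : ι → Matrix (Fin d) (Fin d) ℂ} (hρ : ∀ i, (ρ i).PosSemidef)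
    (hnorm : ∑ i, (ρ i).trace.re ^ 2 = 1)
    {X : Matrix (Fin (n + 1)) ι ℝ} (hX : ∀ k i, X k i = (H k * ρ i).trace.re) :
    (X * Xᵀ).det ≤ (hsGram H).det * (1 / d) * ((1 - 1 / d) / n) ^ n := by
  have hcol (x : Fin (n + 1) → ℝ) : x ᵥ* X = fun i => ((∑ k, (x k : ℂ) • H k) * ρ i).trace.re := by
    ext i
    rw [trace_sum_smul_mul_re]
    simp [vecMul, dotProduct, hX]
  by_cases hΓ : (hsGram H).det = 0
  · obtain ⟨v, hv, hv0⟩ := exists_mulVec_eq_zero_iff.2 hΓ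
    have h0 : ∑ k, (v k : ℂ) • H k = 0 := by
      have h := trace_sum_smul_mul_self_re H v
      have hs := isHermitian_sum_smul hH v
      rw [hv0, dotProduct_zero] at h
      rw [← trace_conjTranspose_mul_self_eq_zero_iff, hs.eq, ← hs.ofReal_trace_mul_re hs, h,
        Complex.ofReal_zero]
    have : (X * Xᵀ).det = 0 := exists_vecMul_eq_zero_iff.1 ⟨v, hv, by
      rw [← vecMul_vecMul, hcol, h0]
      ext
      simp [vecMul, dotProduct]⟩
    simp [this, hΓ]
  have hΓp := (hsGram_posSemidef hH).posDef_iff_det_ne_zero.2 hΓ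
  refine hΓp.det_le_of_dotProduct hn (by exact_mod_cast hd) (posSemidef_self_mul_transpose X) c
    ?_ ?_ ?_
  · rw [← trace_sum_smul_mul_self_re, ← hc]
    simp
  · rw [← mulVec_mulVec, dotProduct_mulVec, mulVec_transpose, hcol, ← hc]
    simp only [Matrix.one_mul, dotProduct, ← sq, hnorm]
  · have htr : (X * Xᵀ * (hsGram H)⁻¹).trace
        = ∑ i, (fun k => X k i) ⬝ᵥ (hsGram H)⁻¹ *ᵥ fun k => X k i := by
      rw [Matrix.mul_assoc, trace_mul_comm, Matrix.mul_assoc, trace_mul_comm, Matrix.mul_assoc,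
        trace_mul_comm, Matrix.mul_assoc, trace_mul_comm, Matrix.mul_assoc]
      rfl
    rw [htr, ← hnorm]
    exact sum_le_sum fun i _ => (dotProduct_hsGram_inv_le hH hΓp (hρ i).1 fun k => hX k i).trans
      (hρ i).trace_mul_self_re_le

theorem one_sub_inv_mul_sub_one_le {a b : ℝ} (ha : 1 ≤ a) (hb : 1 ≤ b) :
    (1 - 1 / a) * (b - 1) ≤ ((√(a * b) - 1) / √a) ^ 2 := by
  have ha0 : 0 < a := by linarith
  have h := Real.sq_sqrt (show 0 ≤ a * b by positivity)
  rw [div_pow, Real.sq_sqrt ha0.le, le_div_iff₀ ha0]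
  have h1 : (1 - 1 / a) * (b - 1) * a = (a - 1) * (b - 1) := by field_simp
  have h2 : √(a * b) ≤ (a + b) / 2 := by
    rw [Real.sqrt_le_left (by positivity)]
    nlinarith [sq_nonneg (a - b)]
  rw [h1]
  nlinarith


theorem Matrix.PosSemidef.ofReal_trace_re {d : Type*} [Fintype d] {A : Matrix d d ℂ}
    (hA : A.PosSemidef) : (A.trace.re : ℂ) = A.trace :=
  Complex.ext rfl (Complex.nonneg_iff.1 hA.trace_nonneg).2

theorem Matrix.sqrt_smul_trace_re_sq {d : Type*} [Fintype d]
    (A : Matrix d d ℂ) {s : ℝ} (hs : 0 ≤ s) (hA : 0 ≤ A.trace.re) :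
    (((√(s / A.trace.re) : ℝ) : ℂ) • A).trace.re ^ 2 = A.trace.re * s := by
  rw [trace_smul, smul_eq_mul, Complex.re_ofReal_mul, mul_pow, Real.sq_sqrt (by positivity)]
  by_cases h : A.trace.re = 0
  · simp [h]
  · field_simp

/-- The observable of a dichotomic measurement on a `d`-dimensional system has squared
Hilbert–Schmidt norm at most `d`. -/
theorem trace_sub_mul_sub_re_le {d : Type*} [Fintype d] [DecidableEq d] {P Q : Matrix d d ℂ}
    (hP : P.PosSemidef) (hQ : Q.PosSemidef) (hPQ : P + Q = 1) :
    ((P - Q) * (P - Q)).trace.re ≤ Fintype.card d := by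
  have h : (P - Q) * (P - Q) = 1 - (4 : ℂ) • (P * Q) := by
    rw [← eq_sub_iff_add_eq'] at hPQ
    rw [hPQ, ofNat_smul_eq_nsmul]
    noncomm_ring
  have h0 := (Complex.le_def.1 (hP.trace_mul_nonneg hQ)).1
  rw [h, trace_sub, trace_smul, trace_one]
  simp at h0 ⊢
  linarith

/-- The data matrix of an unsteerable assemblage is controlled by the Gram determinants of the
operators used on either side. -/
theorem det_sq_le_of_separable {ι : Type*} [Fintype ι] {n dA dB : ℕ} (hn : 1 ≤ n)
    (hdA : 1 ≤ dA) (hdB : 1 ≤ dB)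
    {ω : ι → Matrix (Fin dB) (Fin dB) ℂ} (hω : ∀ i, (ω i).PosSemidef)
    {Z : ι → Matrix (Fin dA) (Fin dA) ℂ} (hZ : ∀ i, (Z i).PosSemidef)
    (hnorm : ∑ i, (Z i).trace * (ω i).trace = 1)
    {B : Fin (n + 1) → Matrix (Fin dB) (Fin dB) ℂ} (hB : ∀ y, (B y).IsHermitian)
    {b : Fin (n + 1) → ℝ} (hb : 1 = ∑ y, (b y : ℂ) • B y)
    {G : Fin (n + 1) → Matrix (Fin dA) (Fin dA) ℂ} (hG : ∀ k, (G k).IsHermitian)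
    {c : Fin (n + 1) → ℝ} (hc : 1 = ∑ k, (c k : ℂ) • G k)
    {D : Matrix (Fin (n + 1)) (Fin (n + 1)) ℝ}
    (hD : ∀ k y, (D k y : ℂ) = ∑ i, (G k * Z i).trace * (B y * ω i).trace) :
    D.det ^ 2 ≤ ((hsGram G).det * (1 / dA) * ((1 - 1 / dA) / n) ^ n)
      * ((hsGram B).det * (1 / dB) * ((1 - 1 / dB) / n) ^ n) := by
  have hα (i : ι) : 0 ≤ (Z i).trace.re := (Complex.le_def.1 (hZ i).trace_nonneg).1
  have hβ (i : ι) : 0 ≤ (ω i).trace.re := (Complex.le_def.1 (hω i).trace_nonneg).1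
  have hsum : ∑ i, (Z i).trace.re * (ω i).trace.re = 1 := by
    have h : ((∑ i, (Z i).trace.re * (ω i).trace.re : ℝ) : ℂ) = 1 := by
      push_cast
      rw [← hnorm]
      exact sum_congr rfl fun i _ => by rw [(hZ i).ofReal_trace_re, (hω i).ofReal_trace_re]
    exact_mod_cast h
  set p : ι → ℝ := fun i => √((ω i).trace.re / (Z i).trace.re) with hp
  set q : ι → ℝ := fun i => √((Z i).trace.re / (ω i).trace.re) with hq
  set X : Matrix (Fin (n + 1)) ι ℝ := of fun k i => (G k * ((p i : ℂ) • Z i)).trace.re with hX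
  set Y : Matrix (Fin (n + 1)) ι ℝ := of fun y i => (B y * ((q i : ℂ) • ω i)).trace.re with hY
  have hDXY : D = X * Yᵀ := by
    ext k y
    have h : (D k y : ℂ) = ((∑ i, (G k * Z i).trace.re * (B y * ω i).trace.re : ℝ) : ℂ) := by
      rw [hD]
      push_cast
      exact sum_congr rfl fun i _ => by
        rw [(hG k).ofReal_trace_mul_re (hZ i).1, (hB y).ofReal_trace_mul_re (hω i).1]
    rw [Complex.ofReal_inj.1 h, mul_apply]
    refine sum_congr rfl fun i _ => ?_
    simp only [hX, hY, transpose_apply, of_apply, Matrix.mul_smul, trace_smul, smul_eq_mul,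
      Complex.re_ofReal_mul]
    by_cases hZ0 : (Z i).trace.re = 0
    · have : Z i = 0 := (hZ i).trace_eq_zero_iff.1 (by rw [← (hZ i).ofReal_trace_re, hZ0]; simp)
      simp [this]
    by_cases hω0 : (ω i).trace.re = 0
    · have : ω i = 0 := (hω i).trace_eq_zero_iff.1 (by rw [← (hω i).ofReal_trace_re, hω0]; simp)
      simp [this]
    have hpq : p i * q i = 1 := by
      rw [hp, hq]
      dsimp only
      rw [← Real.sqrt_mul (div_nonneg (hβ i) (hα i)), div_mul_div_cancel₀ hZ0, div_self hω0,
        Real.sqrt_one]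
    linear_combination -((G k * Z i).trace.re * (B y * ω i).trace.re) * hpq
  have hXX : (X * Xᵀ).det ≤ _ := det_mul_transpose_le_hsGram hn hdA hG hc
    (fun i => (hZ i).smul (Complex.zero_le_real.2 (Real.sqrt_nonneg _) : (0 : ℂ) ≤ p i))
    (by rw [← hsum]; exact sum_congr rfl fun i _ =>
      sqrt_smul_trace_re_sq _ (hβ i) (hα i)) (fun _ _ => rfl)
  have hYY : (Y * Yᵀ).det ≤ _ := det_mul_transpose_le_hsGram hn hdB hB hb
    (fun i => (hω i).smul (Complex.zero_le_real.2 (Real.sqrt_nonneg _) : (0 : ℂ) ≤ q i))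
    (by
      rw [← hsum]
      refine sum_congr rfl fun i _ => ?_
      rw [mul_comm (Z i).trace.re]
      exact sqrt_smul_trace_re_sq _ (hα i) (hβ i)) (fun _ _ => rfl)
  rw [hDXY]
  exact (det_mul_transpose_sq_le X Y).trans (mul_le_mul hXX hYY
    (posSemidef_self_mul_transpose Y).det_nonneg
    ((posSemidef_self_mul_transpose X).det_nonneg.trans hXX))

/-- improved determinant bound for the data matrix of a
`d_B`-dimension-bounded steering scenario when `n_B > √(d_A d_B) − 1` and the
identity lies in the span of the chosen orthonormal operators `G_k`:
non-steerable (normalized) data satisfy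
`|det D| ≤ (1/√d_A)·((√(d_A d_B) − 1)/(n_B √d_A))^{n_B}`. -/
theorem stmt10 (n m nB dA dB : ℕ) (hn : 1 ≤ n) (hm : 2 ≤ m) (hnB : 1 ≤ nB)
    (hdA : 1 ≤ dA) (hdB : 1 ≤ dB)
    (hbig : Real.sqrt ((dA : ℝ) * dB) - 1 < (nB : ℝ))
    (ω : (Fin n → Fin m) → Matrix (Fin dB) (Fin dB) ℂ)
    (hω : ∀ i, (ω i).PosSemidef)
    (Z : (Fin n → Fin m) → Matrix (Fin dA) (Fin dA) ℂ)
    (hZ : ∀ i, (Z i).PosSemidef)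
    (hnorm : ∑ i : Fin n → Fin m, (Z i).trace * (ω i).trace = 1)
    (Mp Mm : Fin nB → Matrix (Fin dB) (Fin dB) ℂ)
    (hMp : ∀ y, (Mp y).PosSemidef) (hMm : ∀ y, (Mm y).PosSemidef)
    (hPOVM : ∀ y, Mp y + Mm y = 1)
    (B : Fin (nB + 1) → Matrix (Fin dB) (Fin dB) ℂ)
    (hB0 : B 0 = 1)
    (hBy : ∀ y : Fin nB, B y.succ = Mp y - Mm y)
    (G : Fin (nB + 1) → Matrix (Fin dA) (Fin dA) ℂ)
    (hGherm : ∀ k, (G k).IsHermitian)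
    (hGortho : ∀ k l, (G k * G l).trace = if k = l then 1 else 0)
    (hGspan : ∃ c : Fin (nB + 1) → ℝ,
      (1 : Matrix (Fin dA) (Fin dA) ℂ) = ∑ k, (c k : ℂ) • G k)
    (D : Matrix (Fin (nB + 1)) (Fin (nB + 1)) ℝ)
    (hD : ∀ k y, (D k y : ℂ)
      = ∑ i : Fin n → Fin m, (G k * Z i).trace * (B y * ω i).trace) :
    |D.det| ≤ (1 / Real.sqrt dA)
      * ((Real.sqrt ((dA : ℝ) * dB) - 1) / (nB * Real.sqrt dA)) ^ nB := by
  obtain ⟨c, hc⟩ := hGspan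
  have hB (y : Fin (nB + 1)) : (B y).IsHermitian := by
    refine Fin.cases ?_ (fun y => ?_) y
    · rw [hB0]
      exact isHermitian_one
    · rw [hBy]
      exact (hMp y).1.sub (hMm y).1
  have hb : (1 : Matrix (Fin dB) (Fin dB) ℂ)
      = ∑ y, ((Pi.single 0 1 : Fin (nB + 1) → ℝ) y : ℂ) • B y := by
    rw [sum_eq_single 0 (fun y _ hy => by simp [hy]) (by simp), hB0]
    simp
  have hsq := det_sq_le_of_separable hnB hdA hdB hω hZ hnorm hB hb hGherm hc hD
  have hΓG : hsGram G = 1 := by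
    ext k l
    rw [hsGram, of_apply, hGortho, one_apply]
    split_ifs <;> simp
  have hdB0 : (0 : ℝ) < dB := by exact_mod_cast hdB
  have hdA0 : (0 : ℝ) < dA := by exact_mod_cast hdA
  have hdA1 : (1 : ℝ) ≤ dA := by exact_mod_cast hdA
  have hdB1 : (1 : ℝ) ≤ dB := by exact_mod_cast hdB
  have hn0 : (0 : ℝ) < nB := by exact_mod_cast hnB
  have hdiag (y : Fin (nB + 1)) : (B y * B y).trace.re ≤ dB := by
    refine Fin.cases ?_ (fun y => ?_) y
    · simp [hB0]
    · rw [hBy]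
      simpa using trace_sub_mul_sub_re_le (hMp y) (hMm y) (hPOVM y)
  have hΓB : (hsGram B).det ≤ (dB : ℝ) ^ (nB + 1) := by
    have h0 := (hsGram_posSemidef hB).trace_nonneg
    refine (hsGram_posSemidef hB).det_le_trace_div_card_pow.trans ?_
    rw [Fintype.card_fin]
    refine pow_le_pow_left₀ (by positivity) ?_ _
    rw [div_le_iff₀ (by positivity)]
    calc (hsGram B).trace ≤ ∑ _y : Fin (nB + 1), (dB : ℝ) := sum_le_sum fun y _ => hdiag y
      _ = _ := by simp [mul_comm]
  have hA1 : 0 ≤ 1 - 1 / (dA : ℝ) := by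
    rw [sub_nonneg, div_le_one hdA0]
    exact hdA1
  have hB1 : 0 ≤ 1 - 1 / (dB : ℝ) := by
    rw [sub_nonneg, div_le_one hdB0]
    exact hdB1
  have hs1 : 1 ≤ √((dA : ℝ) * dB) := Real.one_le_sqrt.2 (one_le_mul_of_one_le_of_one_le hdA1 hdB1)
  refine abs_le_of_sq_le_sq ?_ (mul_nonneg (by positivity)
    (pow_nonneg (div_nonneg (by linarith) (by positivity)) _))
  rw [hΓG, det_one, one_mul] at hsq
  calc D.det ^ 2
      ≤ (1 / dA * ((1 - 1 / dA) / nB) ^ nB)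
        * ((dB : ℝ) ^ (nB + 1) * (1 / dB) * ((1 - 1 / dB) / nB) ^ nB) :=
        hsq.trans (by gcongr)
    _ = 1 / dA * ((1 - 1 / dA) * (dB - 1) / nB ^ 2) ^ nB := by
        have h : (1 - 1 / dA) * (dB - 1) / nB ^ 2
            = ((1 - 1 / dA) / nB) * ((dB : ℝ) * ((1 - 1 / dB) / nB)) := by field_simp
        rw [h, mul_pow, mul_pow, pow_succ]
        field_simp
    _ ≤ 1 / dA * (((√((dA : ℝ) * dB) - 1) / √dA) ^ 2 / nB ^ 2) ^ nB := by
        have := one_sub_inv_mul_sub_one_le hdA1 hdB1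
        have h0 : 0 ≤ (1 - 1 / (dA : ℝ)) * (dB - 1) := mul_nonneg hA1 (by linarith)
        gcongr
    _ = _ := by
        rw [mul_pow, div_pow 1, one_pow, Real.sq_sqrt hdA0.le, ← pow_mul, mul_comm nB 2, pow_mul,
          ← div_pow, div_div, mul_comm (√(dA : ℝ))]
end
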